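/- Let p be a prime and let φ : T → S be the restriction homomorphism from the fixed level of the free C_p-Tambara functor on an underlying generator to its underlying level, i.e. the ring homomorphism with φ(n) = ∏_{i ∈ ZMod p} x_i and φ(t_v) = O(v). Then the image of φ is exactly the subring S^{C_p} of σ-invariant polynomials. -/

import Mathlib

/-!
STATEMENT 4: Let `p` be a prime and let `φ : T → S` be the restriction homomorphism from the
fixed level of the free `C_p`-Tambara functor on an underlying generator to its underlying
level, i.e. the ring homomorphism with `φ(n) = ∏ᵢ xᵢ` and `φ(t_v) = O(v)`.  Then the image of
`φ` is exactly the subring `S^{C_p}` of `σ`-invariant polynomials.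
-/

/-- The shift action of `j : ZMod p` on exponent vectors: `(σʲ v) i = v (i - j)`. -/
def shiftVec (p : ℕ) (j : ZMod p) (v : ZMod p → ℕ) : ZMod p → ℕ :=
  fun i => v (i - j)

/-- The monomial `x^v = ∏ᵢ xᵢ^{v i}`. -/
noncomputable def expMonomial (p : ℕ) [NeZero p] (v : ZMod p → ℕ) :
    MvPolynomial (ZMod p) ℤ :=
  MvPolynomial.monomial (Finsupp.equivFunOnFinite.symm v) 1

/-- The orbit sum `O(v) = Σ_{j = 0}^{p-1} x^{σʲ v}`. -/
noncomputable def orbitSum (p : ℕ) [NeZero p] (v : ZMod p → ℕ) :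
    MvPolynomial (ZMod p) ℤ :=
  ∑ j : ZMod p, expMonomial p (shiftVec p j v)

/-- Generators of the presented ring `T`: `none` is the generator `n`, and `some v` is the
generator `t_v` for an exponent vector `v : ZMod p → ℕ`. -/
abbrev TGen (p : ℕ) : Type := Option (ZMod p → ℕ)

/-- The ideal of relations defining `T`:
`t_0̄² = p t_0̄`, `t_v = t_{σv}`, `n t_v = t_{v + 1̄}`, and
`t_v t_w = Σ_{j=0}^{p-1} t_{v + σʲ w}`. -/
noncomputable def relIdeal (p : ℕ) [NeZero p] : Ideal (MvPolynomial (TGen p) ℤ) :=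
  Ideal.span
    ({MvPolynomial.X (some (0 : ZMod p → ℕ)) ^ 2 -
        (p : MvPolynomial (TGen p) ℤ) * MvPolynomial.X (some (0 : ZMod p → ℕ))} ∪
      Set.range (fun v : ZMod p → ℕ =>
        MvPolynomial.X (some v) - MvPolynomial.X (some (shiftVec p 1 v))) ∪
      Set.range (fun v : ZMod p → ℕ =>
        MvPolynomial.X none * MvPolynomial.X (some v) - MvPolynomial.X (some (v + 1))) ∪
      Set.range (fun vw : (ZMod p → ℕ) × (ZMod p → ℕ) =>
        MvPolynomial.X (some vw.1) * MvPolynomial.X (some vw.2) -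
          ∑ j : ZMod p, MvPolynomial.X (some (vw.1 + shiftVec p j vw.2))))

/-- The presented commutative ring `T`: the value at the fixed level `C_p/C_p` of the free
`C_p`-Tambara functor on an underlying generator. -/
abbrev TRing (p : ℕ) [NeZero p] : Type := MvPolynomial (TGen p) ℤ ⧸ relIdeal p

/-- The image of `n` in `T`. -/
noncomputable def nElt (p : ℕ) [NeZero p] : TRing p :=
  Ideal.Quotient.mk (relIdeal p) (MvPolynomial.X none)

/-- The image of `t_v` in `T`. -/
noncomputable def tElt (p : ℕ) [NeZero p] (v : ZMod p → ℕ) : TRing p :=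
  Ideal.Quotient.mk (relIdeal p) (MvPolynomial.X (some v))


open MvPolynomial in
/-- Shifting an exponent vector is the same as renaming the variables of its monomial. -/
theorem expMonomial_shiftVec (p : ℕ) [NeZero p] (j : ZMod p) (v : ZMod p → ℕ) :
    expMonomial p (shiftVec p j v) = rename (fun i => i + j) (expMonomial p v) := by
  rw [expMonomial, expMonomial, rename_monomial]
  refine congrArg (monomial · 1) (Finsupp.ext fun i => ?_)
  have h := Finsupp.mapDomain_equiv_apply (f := Equiv.addRight j)
    (Finsupp.equivFunOnFinite.symm v) i
  simp only [Equiv.coe_addRight] at h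
  rw [h]
  simp [shiftVec, sub_eq_add_neg]

theorem shiftVec_zero (p : ℕ) (v : ZMod p → ℕ) : shiftVec p 0 v = v :=
  funext fun i => congrArg v (sub_zero i)

theorem shiftVec_shiftVec (p : ℕ) (j k : ZMod p) (v : ZMod p → ℕ) :
    shiftVec p j (shiftVec p k v) = shiftVec p (k + j) v := by
  funext i
  simp only [shiftVec]
  congr 1
  ring

/-- Orbit sums are invariant under the cyclic shift of the variables. -/
theorem rename_orbitSum (p : ℕ) [NeZero p] (v : ZMod p → ℕ) :
    MvPolynomial.rename (fun i => i + 1) (orbitSum p v) = orbitSum p v := by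
  simp only [orbitSum, map_sum, ← expMonomial_shiftVec, shiftVec_shiftVec]
  exact Equiv.sum_comp (Equiv.addRight (1 : ZMod p)) fun j => expMonomial p (shiftVec p j v)

open MvPolynomial in
/-- The product of all variables is invariant under the cyclic shift. -/
theorem rename_prod_X (p : ℕ) [NeZero p] :
    rename (fun i => i + 1) (∏ i : ZMod p, X i : MvPolynomial (ZMod p) ℤ) = ∏ i, X i := by
  simp only [map_prod, rename_X]
  exact Equiv.prod_comp (Equiv.addRight (1 : ZMod p)) X

/-- A vector fixed by a nontrivial shift is constant when `p` is prime. -/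
theorem eq_of_shiftVec_eq_self {p : ℕ} (hp : p.Prime) {j : ZMod p} (hj : j ≠ 0)
    {v : ZMod p → ℕ} (h : shiftVec p j v = v) (i : ZMod p) : v i = v 0 := by
  have : Fact p.Prime := ⟨hp⟩
  have step (n : ℕ) : v (n * j) = v 0 := by
    induction n with
    | zero => simp
    | succ n ih =>
      have hn := congrFun h ((n + 1 : ℕ) * j)
      simp only [shiftVec] at hn
      rw [← hn, ← ih]
      congr 1
      push_cast
      ring
  have hi := step (i * j⁻¹).val
  rwa [ZMod.natCast_val, ZMod.cast_id', id, mul_assoc, inv_mul_cancel₀ hj, mul_one] at hi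

/-- The shifts of a nonconstant vector are pairwise distinct when `p` is prime. -/
theorem shiftVec_injective {p : ℕ} (hp : p.Prime) {v : ZMod p → ℕ} (hv : ¬ ∀ i, v i = v 0) :
    Function.Injective fun j => shiftVec p j v := by
  intro j k hjk
  by_contra hne
  refine hv (eq_of_shiftVec_eq_self hp (sub_ne_zero.2 hne) ?_)
  have h := congrArg (shiftVec p (-k)) hjk
  simp only [shiftVec_shiftVec, add_neg_cancel, ← sub_eq_add_neg] at h
  rw [h, shiftVec_zero]

open MvPolynomial in
/-- Coefficients of a shift-invariant polynomial are constant along orbits. -/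
theorem coeff_shiftVec_of_rename_eq {p : ℕ} [NeZero p] {f : MvPolynomial (ZMod p) ℤ}
    (hf : rename (fun i : ZMod p => i + 1) f = f) (j : ZMod p) (v : ZMod p → ℕ) :
    coeff (Finsupp.equivFunOnFinite.symm (shiftVec p j v)) f =
      coeff (Finsupp.equivFunOnFinite.symm v) f := by
  have hstep (w : ZMod p → ℕ) : coeff (Finsupp.equivFunOnFinite.symm (shiftVec p 1 w)) f =
      coeff (Finsupp.equivFunOnFinite.symm w) f := by
    have hw := expMonomial_shiftVec p 1 w
    rw [expMonomial, expMonomial, rename_monomial] at hw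
    rw [monomial_left_injective one_ne_zero hw]
    conv_lhs => rw [← hf]
    exact coeff_rename_mapDomain _ (add_left_injective 1) _ _
  have hnat (n : ℕ) : coeff (Finsupp.equivFunOnFinite.symm (shiftVec p n v)) f =
      coeff (Finsupp.equivFunOnFinite.symm v) f := by
    induction n with
    | zero => rw [Nat.cast_zero, shiftVec_zero]
    | succ n ih => rw [Nat.cast_succ, ← shiftVec_shiftVec, hstep, ih]
  simpa using hnat j.val

open MvPolynomial in
/-- The coefficients of the orbit sum of a nonconstant vector are `0` or `1`. -/
theorem coeff_orbitSum {p : ℕ} (hp : p.Prime) [NeZero p] {v : ZMod p → ℕ}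
    (hv : ¬ ∀ i, v i = v 0) (w : ZMod p →₀ ℕ) [Decidable (∃ j, shiftVec p j v = w)] :
    coeff w (orbitSum p v) = if ∃ j, shiftVec p j v = w then 1 else 0 := by
  classical
  simp only [orbitSum, coeff_sum, expMonomial, coeff_monomial, Equiv.symm_apply_eq]
  split_ifs with h
  · obtain ⟨j, hj⟩ := h
    rw [Finset.sum_eq_single j]
    · exact if_pos hj
    · intro k _ hk
      exact if_neg fun h => hk (shiftVec_injective hp hv (h.trans hj.symm))
    · simp
  · exact Finset.sum_eq_zero fun j _ => if_neg fun hj => h ⟨j, hj⟩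

open MvPolynomial in
/-- A monomial with constant exponent vector is a power of the product of all variables. -/
theorem monomial_eq_prod_X_pow {p : ℕ} [NeZero p] {m : ZMod p →₀ ℕ} (hm : ∀ i, m i = m 0) :
    monomial m (1 : ℤ) = (∏ i : ZMod p, X i) ^ m 0 := by
  rw [monomial_eq, C_1, one_mul, Finsupp.prod_fintype _ _ fun _ => pow_zero _,
    ← Finset.prod_pow]
  exact Finset.prod_congr rfl fun i _ => by rw [hm i]

open MvPolynomial in
/-- A subring containing the product of the variables and all orbit sums contains every
shift-invariant polynomial. -/
theorem mem_of_rename_eq {p : ℕ} (hp : p.Prime) [NeZero p]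
    {R : Subring (MvPolynomial (ZMod p) ℤ)} (hn : ∏ i : ZMod p, X i ∈ R)
    (ht : ∀ v, orbitSum p v ∈ R) (f : MvPolynomial (ZMod p) ℤ)
    (hf : rename (fun i : ZMod p => i + 1) f = f) : f ∈ R := by
  classical
  induction hc : f.support.card using Nat.strong_induction_on generalizing f with
  | _ c ih =>
    subst hc
    by_cases hf0 : f = 0
    · exact hf0 ▸ R.zero_mem
    obtain ⟨m, hm⟩ := support_nonempty.2 hf0
    suffices h : ∃ g ∈ R, rename (fun i : ZMod p => i + 1) g = g ∧ coeff m g = coeff m f ∧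
        ∀ w, coeff w f = 0 → coeff w g = 0 by
      obtain ⟨g, hgR, hg, hgm, hgw⟩ := h
      rw [← sub_add_cancel f g]
      refine R.add_mem (ih _ (Finset.card_lt_card ?_) (f - g) (by rw [map_sub, hf, hg]) rfl) hgR
      refine Finset.ssubset_iff_of_subset ?_ |>.2 ⟨m, hm, by simp [hgm]⟩
      intro w hw
      rw [mem_support_iff, coeff_sub] at hw
      rw [mem_support_iff]
      intro h0
      exact hw (by rw [h0, hgw w h0, sub_zero])
    by_cases hmc : ∀ i, m i = m 0
    · refine ⟨coeff m f • monomial m 1, R.zsmul_mem ?_ _, ?_, ?_, ?_⟩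
      · rw [monomial_eq_prod_X_pow hmc]
        exact R.pow_mem hn _
      · rw [map_zsmul, monomial_eq_prod_X_pow hmc, map_pow, rename_prod_X]
      · rw [coeff_smul, coeff_monomial, if_pos rfl, smul_eq_mul, mul_one]
      · intro w hw
        rw [coeff_smul, coeff_monomial]
        split_ifs with h
        · rw [h, hw, zero_smul]
        · exact smul_zero _
    · refine ⟨coeff m f • orbitSum p m, R.zsmul_mem (ht _) _, ?_, ?_, ?_⟩
      · rw [map_zsmul, rename_orbitSum]
      · rw [coeff_smul, coeff_orbitSum hp hmc, if_pos ⟨0, shiftVec_zero p m⟩, smul_eq_mul,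
          mul_one]
      · intro w hw
        rw [coeff_smul, coeff_orbitSum hp hmc]
        split_ifs with h
        · obtain ⟨j, hj⟩ := h
          have hmw := coeff_shiftVec_of_rename_eq hf j m
          rw [hj, Finsupp.equivFunOnFinite_symm_coe, Finsupp.equivFunOnFinite_symm_coe, hw] at hmw
          rw [← hmw, zero_smul]
        · exact smul_zero _

theorem statement4 (p : ℕ) (hp : p.Prime) [NeZero p]
    (φ : TRing p →+* MvPolynomial (ZMod p) ℤ)
    (hφn : φ (nElt p) = ∏ i : ZMod p, MvPolynomial.X i)
    (hφt : ∀ v : ZMod p → ℕ, φ (tElt p v) = orbitSum p v) :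
    Set.range (⇑φ) =
      {f : MvPolynomial (ZMod p) ℤ | MvPolynomial.rename (fun i : ZMod p => i + 1) f = f} := by
  ext f
  constructor
  · rintro ⟨t, rfl⟩
    suffices h : (MvPolynomial.rename fun i : ZMod p => i + 1).toRingHom.comp φ = φ from
      RingHom.congr_fun h t
    refine Ideal.Quotient.ringHom_ext (MvPolynomial.ringHom_ext (fun z => by simp) ?_)
    rintro (_ | v)
    · change MvPolynomial.rename _ (φ (nElt p)) = φ (nElt p)
      rw [hφn, rename_prod_X]
    · change MvPolynomial.rename _ (φ (tElt p v)) = φ (tElt p v)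
      rw [hφt, rename_orbitSum]
  · exact mem_of_rename_eq (R := φ.range) hp ⟨_, hφn⟩ (fun v => ⟨_, hφt v⟩) f
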